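/- Let T be an ergodic measure-preserving ℤ³-action on a probability space (Ω,A,μ) equipped with a completely commuting invariant filtration (F_{i,j,k})_{i,j,k∈ℤ} with F_{∞,∞,∞}=A, and let I = I̅₁ ∨ I̅₂ ∨ I̅₃ where I̅₁, I̅₂, I̅₃ are respectively the σ-algebras of sets invariant under the ℤ²-actions (T_{0,j,k}), (T_{i,0,k}), (T_{i,j,0}). Then the family (I ∩ F_{i,j,k})_{i,j,k∈ℤ} is itself a completely commuting invariant filtration for T. -/

import Mathlib

open MeasureTheory

/-- The σ-algebra of subsets of `X` that are `m`-measurable and invariant under every map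
of the family `U : ι → X → X`. -/
def invariantSets {X ι : Type*} (m : MeasurableSpace X) (U : ι → X → X) :
    MeasurableSpace X where
  MeasurableSet' s := MeasurableSet[m] s ∧ ∀ i, U i ⁻¹' s = s
  measurableSet_empty := ⟨m.measurableSet_empty, fun _ => by simp⟩
  measurableSet_compl := fun s hs =>
    ⟨m.measurableSet_compl s hs.1, fun i => by rw [Set.preimage_compl, hs.2 i]⟩
  measurableSet_iUnion := fun f hf =>
    ⟨m.measurableSet_iUnion f (fun n => (hf n).1), fun i => by
      rw [Set.preimage_iUnion]
      exact Set.iUnion_congr fun n => (hf n).2 i⟩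

/-- Extension of a (monotone) `ℤ³`-indexed filtration to indices in `ℤ ∪ {∞}`:
`extFiltration F i j k` is the σ-algebra generated by all `F a b c` with `a ≤ i`,
`b ≤ j`, `c ≤ k`. -/
def extFiltration {Ω : Type*} (F : ℤ → ℤ → ℤ → MeasurableSpace Ω)
    (i j k : WithTop ℤ) : MeasurableSpace Ω :=
  ⨆ (a : ℤ) (_ : (a : WithTop ℤ) ≤ i) (b : ℤ) (_ : (b : WithTop ℤ) ≤ j)
    (c : ℤ) (_ : (c : WithTop ℤ) ≤ k), F a b c


open Filter Topology

theorem hh_setInt {Ω : Type*} {m0 : MeasurableSpace Ω} {μ : Measure Ω}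
    {S : Ω → Ω} (hS : MeasurePreserving S μ μ) {t : Set Ω} (ht : MeasurableSet t)
    (g : Ω → ℝ) (hg : Integrable g μ) :
    ∫ x in S ⁻¹' t, g (S x) ∂μ = ∫ x in t, g x ∂μ := by
  have := setIntegral_map (μ := μ) (g := S) (f := g) ht
    (by rw [hS.map_eq]; exact hg.aestronglyMeasurable) hS.measurable.aemeasurable
  rw [hS.map_eq] at this
  exact this.symm

theorem hh_limsup {Ω : Type*} {m : MeasurableSpace Ω} (f : ℤ × ℤ → Ω → ENNReal)
    (hf : ∀ q, Measurable (f q)) : Measurable fun x => limsup (fun q => f q x) atBot :=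
  Measurable.limsup' hf ⟨atBot_basis, Set.to_countable _⟩ (fun _ => Set.to_countable _)

theorem hh_condExp_comp {Ω : Type*} {G G' : MeasurableSpace Ω} {m0 : MeasurableSpace Ω} {μ : Measure Ω}
    [IsProbabilityMeasure μ] {S : Ω → Ω} (hS : MeasurePreserving S μ μ)
    (hG : G ≤ m0) (hG' : G' ≤ m0) (h : G = G'.comap S)
    {f : Ω → ℝ} (hf : Integrable f μ) (hinv : f ∘ S = f) :
    (μ[f|G']) ∘ S =ᵐ[μ] μ[f|G] := by
  subst h
  refine ae_eq_condExp_of_forall_setIntegral_eq hG hf ?_ ?_ ?_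
  · intro s _ _
    exact (hS.integrable_comp_of_integrable integrable_condExp).integrableOn
  · rintro s ⟨t, ht, rfl⟩ _
    have h1 := hh_setInt hS (hG' t ht)
    have h2 := h1 _ hf
    have h3 : ∀ x, f (S x) = f x := fun x => congrFun hinv x
    simp only [h3] at h2
    rw [h2]
    refine (h1 _ integrable_condExp).trans ?_
    exact setIntegral_condExp hG' hf ht
  · exact (stronglyMeasurable_condExp.comp_measurable
      (measurable_iff_comap_le.mpr le_rfl)).aestronglyMeasurable

theorem hh_condExp_eq_of_le {Ω : Type*} {G G' : MeasurableSpace Ω} {m0 : MeasurableSpace Ω} {μ : Measure Ω}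
    [IsProbabilityMeasure μ] {S : Ω → Ω} (hS : MeasurePreserving S μ μ)
    (hG : G ≤ m0) (hG' : G' ≤ m0) (h : G = G'.comap S) (hle : G ≤ G')
    {f : Ω → ℝ} (hf : Integrable f μ) (hinv : f ∘ S = f) (hb : ∀ x, |f x| ≤ 1) :
    μ[f|G'] =ᵐ[μ] μ[f|G] := by
  have hcomp := hh_condExp_comp hS hG hG' h hf hinv
  set u := μ[f|G'] with hu
  set v := μ[f|G] with hv
  have hui : Integrable u μ := integrable_condExp
  have hvi : Integrable v μ := integrable_condExp
  have hub : ∀ᵐ x ∂μ, |u x| ≤ 1 := by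
    simpa using ae_bdd_abs_condExp_of_ae_bdd_abs (R := (1:ℝ)) (m := G') (ae_of_all μ hb)
  have hvb : ∀ᵐ x ∂μ, |v x| ≤ 1 := by
    simpa using ae_bdd_abs_condExp_of_ae_bdd_abs (R := (1:ℝ)) (m := G) (ae_of_all μ hb)
  have huu : Integrable (u * u) μ := hui.bdd_mul hui.aestronglyMeasurable (c := 1) hub
  have hvu : Integrable (v * u) μ := hui.bdd_mul hvi.aestronglyMeasurable (c := 1) hvb
  have hvv : Integrable (v * v) μ := hvi.bdd_mul hvi.aestronglyMeasurable (c := 1) hvb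
  have e1 : ∫ x, (v * v) x ∂μ = ∫ x, (u * u) x ∂μ := by
    have : ∫ x, (v * v) x ∂μ = ∫ x, (u * u) (S x) ∂μ := by
      apply integral_congr_ae
      filter_upwards [hcomp] with x hx
      simp only [Pi.mul_apply, Function.comp] at hx ⊢
      rw [hx]
    rw [this]
    simpa using hh_setInt hS MeasurableSet.univ _ huu
  have e2 : ∫ x, (v * u) x ∂μ = ∫ x, (v * v) x ∂μ := by
    rw [← integral_condExp hG (f := v * u)]
    apply integral_congr_ae
    refine (condExp_mul_of_aestronglyMeasurable_left
      stronglyMeasurable_condExp.aestronglyMeasurable hvu hui).trans ?_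
    filter_upwards [condExp_condExp_of_le (f := f) (μ := μ) hle hG'] with x hx
    simp only [Pi.mul_apply]
    rw [hu, hx]
  have e3 : ∫ x, (u x - v x) ^ 2 ∂μ = 0 := by
    have : (fun x => (u x - v x) ^ 2) =
        fun x => (u * u) x - 2 * (v * u) x + (v * v) x := by
      funext x; simp only [Pi.mul_apply]; ring
    rw [this]
    rw [integral_add (f := fun x => (u * u) x - 2 * (v * u) x) (huu.sub (hvu.const_mul 2)) hvv,
      integral_sub (f := fun x => (u * u) x) huu (hvu.const_mul 2), integral_const_mul]
    linarith
  have hint : Integrable (fun x => (u x - v x) ^ 2) μ := by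
    have : (fun x => (u x - v x) ^ 2) =
        fun x => (u * u) x - 2 * (v * u) x + (v * v) x := by
      funext x; simp only [Pi.mul_apply]; ring
    rw [this]
    exact (huu.sub (hvu.const_mul 2)).add hvv
  have := (integral_eq_zero_iff_of_nonneg (fun x => sq_nonneg _) hint).1 e3
  filter_upwards [this] with x hx
  have : (u x - v x) ^ 2 = 0 := hx
  have := pow_eq_zero_iff (two_ne_zero) |>.1 this
  linarith

/-- Conditional expectations of an invariant set along the invariant directions. -/
theorem hh_dir {Ω : Type*} {m0 : MeasurableSpace Ω} {μ : Measure Ω}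
    [IsProbabilityMeasure μ] (U : ℤ × ℤ → Ω → Ω)
    (hUadd : ∀ p q, U (p + q) = U p ∘ U q) (hU : ∀ p, MeasurePreserving (U p) μ μ)
    (G : ℤ × ℤ → MeasurableSpace Ω) (hG : ∀ p, G p ≤ m0) (hmono : Monotone G)
    (hGU : ∀ p q, G (p + q) = (G p).comap (U q))
    {s : Set Ω} (hs : MeasurableSet[invariantSets m0 U] s) :
    (∀ p q, μ[s.indicator (fun _ => (1:ℝ))|G p] =ᵐ[μ] μ[s.indicator (fun _ => (1:ℝ))|G q]) ∧
    ∀ p, AEStronglyMeasurable[invariantSets m0 U ⊓ G p]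
      (μ[s.indicator (fun _ => (1:ℝ))|G p]) μ := by
  obtain ⟨hsm, hsi⟩ := hs
  set f : Ω → ℝ := s.indicator (fun _ => (1:ℝ)) with hf
  have hfi : Integrable f μ := (integrable_const (1:ℝ)).indicator hsm
  have hfb : ∀ x, |f x| ≤ 1 := by
    intro x
    by_cases hx : x ∈ s <;> simp [hf, hx]
  have hfinv : ∀ p, f ∘ U p = f := by
    intro p
    funext x
    have : U p x ∈ s ↔ x ∈ s := by
      conv_rhs => rw [← hsi p]
      rfl
    by_cases hx : x ∈ s
    · simp [hf, hx, this.2 hx]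
    · have h2 : U p x ∉ s := fun h => hx (this.1 h)
      simp [hf, hx, h2]
  have hle : ∀ p q, p ≤ q → μ[f|G q] =ᵐ[μ] μ[f|G p] := by
    intro p q hpq
    refine hh_condExp_eq_of_le (hU (p - q)) (hG p) (hG q) ?_ (hmono hpq) hfi (hfinv _) hfb
    rw [← hGU, add_sub_cancel]
  have hA : ∀ p q, μ[f|G p] =ᵐ[μ] μ[f|G q] := fun p q =>
    (hle (p ⊓ q) p inf_le_left).trans (hle (p ⊓ q) q inf_le_right).symm
  refine ⟨hA, fun p => ?_⟩
  set v := μ[f|G p] with hv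
  have hvm : Measurable[G p] v := stronglyMeasurable_condExp.measurable
  have hvU : ∀ q, v ∘ U q =ᵐ[μ] v := fun q =>
    (hh_condExp_comp (hU q) (hG (p + q)) (hG p) (hGU p q) hfi (hfinv q)).trans (hA _ _)
  have hv0 : 0 ≤ᵐ[μ] v := condExp_nonneg (ae_of_all _ fun x => by
    by_cases hx : x ∈ s <;> simp [hf, hx])
  let w : Ω → ENNReal := fun x => limsup (fun q : ℤ × ℤ => ENNReal.ofReal (v (U q x))) atBot
  have hwG : Measurable[G p] w := by
    have e : w = fun x => limsup (fun q : ℤ × ℤ =>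
        (if q ≤ 0 then (fun y => ENNReal.ofReal (v (U q y))) else fun _ => 0) x) atBot := by
      funext x
      apply limsup_congr
      filter_upwards [Iic_mem_atBot (0 : ℤ × ℤ)] with q hq
      have hq : q ≤ 0 := hq
      simp [hq]
    rw [e]
    refine hh_limsup (m := G p) _ ?_
    intro q
    split_ifs with hq
    · have h1 : Measurable[G (p + q)] (fun y => v (U q y)) := by
        rw [hGU]
        exact hvm.comp (measurable_iff_comap_le.mpr le_rfl)
      have h2 : Measurable[G p] (fun y => v (U q y)) :=
        h1.mono (hmono (by simpa using hq)) le_rfl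
      exact ENNReal.measurable_ofReal.comp h2
    · exact measurable_const
  have hwU : ∀ q x, w (U q x) = w x := by
    intro q x
    have h1 : ∀ r, U r (U q x) = U (r + q) x := fun r => by rw [hUadd]; rfl
    simp only [w, h1]
    have h2 : map (fun r : ℤ × ℤ => r + q) atBot = atBot := (OrderIso.addRight q).map_atBot
    conv_rhs => rw [← h2]
    rfl
  have hwI : Measurable[invariantSets m0 U ⊓ G p] w := by
    intro t ht
    refine MeasurableSpace.measurableSet_inf.2 ⟨⟨hG p _ (hwG ht), fun q => ?_⟩, hwG ht⟩
    ext x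
    simp only [Set.mem_preimage, hwU]
  refine ⟨fun x => (w x).toReal, (Measurable.ennreal_toReal hwI).stronglyMeasurable, ?_⟩
  filter_upwards [ae_all_iff.2 hvU, hv0] with x hx hx0
  have h1 : ∀ q, v (U q x) = v x := hx
  simp only [w, h1, limsup_const]
  rw [ENNReal.toReal_ofReal hx0]

/-- Two conditional expectations agreeing on a generating π-system of `I` agree on `L¹(I)`. -/
theorem hh_ext {Ω : Type*} {A B I : MeasurableSpace Ω} {m0 : MeasurableSpace Ω} {μ : Measure Ω}
    [IsProbabilityMeasure μ] (hA : A ≤ m0) (hB : B ≤ m0) (hI : I ≤ m0)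
    (C : Set (Set Ω)) (hC : IsPiSystem C) (hgen : I = MeasurableSpace.generateFrom C)
    (hCs : ∀ s ∈ C, μ[s.indicator (fun _ => (1:ℝ))|A] =ᵐ[μ] μ[s.indicator (fun _ => (1:ℝ))|B])
    {h : Ω → ℝ} (hh : Integrable h μ) (hhm : AEStronglyMeasurable[I] h μ) :
    μ[h|A] =ᵐ[μ] μ[h|B] := by
  have hset : ∀ s, MeasurableSet[I] s →
      μ[s.indicator (fun _ => (1:ℝ))|A] =ᵐ[μ] μ[s.indicator (fun _ => (1:ℝ))|B] := by
    refine MeasurableSpace.induction_on_inter (m := I) hgen hC ?_ hCs ?_ ?_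
    · simp only [Set.indicator_empty]
      have : (fun _ : Ω => (0:ℝ)) = 0 := rfl
      rw [this, condExp_zero, condExp_zero]
    · intro t ht iht
      have ht0 := hI t ht
      have e : tᶜ.indicator (fun _ => (1:ℝ)) = (fun _ => (1:ℝ)) - t.indicator (fun _ => (1:ℝ)) := by
        rw [Set.indicator_compl]
      rw [e]
      have hti : Integrable (t.indicator (fun _ => (1:ℝ))) μ :=
        (integrable_const (1:ℝ)).indicator ht0
      refine (condExp_sub (integrable_const _) hti _).trans
        (EventuallyEq.trans ?_ (condExp_sub (integrable_const _) hti _).symm)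
      rw [condExp_const hA, condExp_const hB]
      filter_upwards [iht] with x hx
      simp [hx]
    · intro f hd hfm ihf
      have e : (⋃ i, f i).indicator (fun _ => (1:ℝ)) =
          fun a => ∑' i, (f i).indicator (fun _ => (1:ℝ)) a := by
        funext a
        by_cases ha : ∃ i, a ∈ f i
        · obtain ⟨i, hi⟩ := ha
          rw [tsum_eq_single i]
          · simp [hi, Set.mem_iUnion.2 ⟨i, hi⟩]
          · intro j hj
            have : a ∉ f j := fun h => Set.disjoint_left.1 (hd hj) h hi
            simp [this]
        · have h1 : a ∉ ⋃ i, f i := fun h => ha (Set.mem_iUnion.1 h)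
          have h2 : ∀ i, a ∉ f i := fun i h => ha ⟨i, h⟩
          simp [h2]
      rw [e]
      have hm : ∀ i, AEStronglyMeasurable ((f i).indicator (fun _ => (1:ℝ))) μ := fun i =>
        ((integrable_const (1:ℝ)).indicator (hI _ (hfm i))).aestronglyMeasurable
      have hfin : ∑' i, ∫⁻ a, ‖(f i).indicator (fun _ => (1:ℝ)) a‖ₑ ∂μ ≠ ⊤ := by
        have : ∀ i, ∫⁻ a, ‖(f i).indicator (fun _ => (1:ℝ)) a‖ₑ ∂μ = μ (f i) := by
          intro i
          simp only [enorm_indicator_eq_indicator_enorm]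
          rw [lintegral_indicator (hI _ (hfm i))]
          simp
        simp only [this]
        rw [← measure_iUnion hd (fun i => hI _ (hfm i))]
        exact measure_ne_top _ _
      refine (condExp_tsum hm hfin).trans (EventuallyEq.trans ?_ (condExp_tsum hm hfin).symm)
      filter_upwards [ae_all_iff.2 ihf] with x hx
      simp only [hx]
  refine MemLp.induction_stronglyMeasurable (p := 1) hI ENNReal.one_ne_top
    (fun h => μ[h|A] =ᵐ[μ] μ[h|B]) ?_ ?_ ?_ ?_ (memLp_one_iff_integrable.2 hh) hhm
  · intro c s hs _
    have e : s.indicator (fun _ => c) = c • s.indicator (fun _ => (1:ℝ)) := by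
      funext x
      by_cases hx : x ∈ s <;> simp [hx]
    rw [e]
    refine (condExp_smul c _ _).trans (EventuallyEq.trans ?_ (condExp_smul c _ _).symm)
    filter_upwards [hset s hs] with x hx
    simp [hx]
  · intro f g _ hf hg _ _ ihf ihg
    have hf := memLp_one_iff_integrable.1 hf
    have hg := memLp_one_iff_integrable.1 hg
    exact (condExp_add hf hg _).trans ((ihf.add ihg).trans (condExp_add hf hg _).symm)
  · have e : {f : lpMeas ℝ ℝ I 1 μ | μ[(f : Ω → ℝ)|A] =ᵐ[μ] μ[(f : Ω → ℝ)|B]} =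
        {f : lpMeas ℝ ℝ I 1 μ | condExpL1CLM ℝ hA μ (f : Lp ℝ 1 μ)
          = condExpL1CLM ℝ hB μ (f : Lp ℝ 1 μ)} := by
      ext f
      have hi : Integrable ((f : Lp ℝ 1 μ) : Ω → ℝ) μ := L1.integrable_coeFn _
      have hA1 := condExp_ae_eq_condExpL1CLM hA hi
      have hB1 := condExp_ae_eq_condExpL1CLM hB hi
      rw [Integrable.toL1_coeFn] at hA1 hB1
      simp only [Set.mem_ofPred_eq]
      constructor
      · intro h
        exact Lp.ext (hA1.symm.trans (h.trans hB1))
      · intro h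
        rw [h] at hA1
        exact hA1.trans hB1.symm
    rw [e]
    exact isClosed_eq ((condExpL1CLM ℝ hA μ).continuous.comp continuous_subtype_val)
      ((condExpL1CLM ℝ hB μ).continuous.comp continuous_subtype_val)
  · intro f g hfg _ ih
    exact (condExp_congr_ae hfg.symm).trans (ih.trans (condExp_congr_ae hfg))

/-- Integrable and a.e. bounded by one. -/
def HhBd {Ω : Type*} {m0 : MeasurableSpace Ω} (μ : Measure Ω) (f : Ω → ℝ) : Prop :=
  Integrable f μ ∧ ∀ᵐ x ∂μ, |f x| ≤ 1

theorem HhBd.mul {Ω : Type*} {m0 : MeasurableSpace Ω} {μ : Measure Ω} {f g : Ω → ℝ}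
    (hf : HhBd μ f) (hg : HhBd μ g) : HhBd μ (f * g) := by
  refine ⟨hg.1.bdd_mul hf.1.aestronglyMeasurable (c := 1) hf.2, ?_⟩
  filter_upwards [hf.2, hg.2] with x h1 h2
  simp only [Pi.mul_apply, abs_mul]
  exact mul_le_one₀ h1 (abs_nonneg _) h2

theorem HhBd.ce {Ω : Type*} {m m0 : MeasurableSpace Ω} {μ : Measure Ω} {f : Ω → ℝ}
    (hf : HhBd μ f) : HhBd μ (μ[f|m]) :=
  ⟨integrable_condExp, by
    simpa using ae_bdd_abs_condExp_of_ae_bdd_abs (R := (1:ℝ)) (m := m) hf.2⟩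

theorem hh_prod {Ω : Type*} {m0 : MeasurableSpace Ω} {μ : Measure Ω} [IsProbabilityMeasure μ]
    (F : ℤ → ℤ → ℤ → MeasurableSpace Ω)
    (hFle : ∀ i j k, F i j k ≤ m0)
    (hFmono : ∀ ⦃i j k i' j' k' : ℤ⦄, i ≤ i' → j ≤ j' → k ≤ k' → F i j k ≤ F i' j' k')
    (hFtop : extFiltration F ⊤ ⊤ ⊤ = m0)
    {f1 f2 f3 : Ω → ℝ} (h1 : HhBd μ f1) (h2 : HhBd μ f2) (h3 : HhBd μ f3)
    (m1 : StronglyMeasurable f1) (m2 : StronglyMeasurable f2) (m3 : StronglyMeasurable f3)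
    (e1 : ∀ i j k j' k', μ[f1|F i j k] =ᵐ[μ] μ[f1|F i j' k'])
    (e2 : ∀ i j k i' k', μ[f2|F i j k] =ᵐ[μ] μ[f2|F i' j k'])
    (e3 : ∀ i j k i' j', μ[f3|F i j k] =ᵐ[μ] μ[f3|F i' j' k])
    (i j k : ℤ) :
    μ[f1 * f2 * f3|F i j k] =ᵐ[μ] μ[f1|F i j k] * μ[f2|F i j k] * μ[f3|F i j k] := by
  set a1 := μ[f1|F i j k] with ha1
  set a2 := μ[f2|F i j k] with ha2
  set a3 := μ[f3|F i j k] with ha3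
  have b1 : HhBd μ a1 := h1.ce
  have b2 : HhBd μ a2 := h2.ce
  have b3 : HhBd μ a3 := h3.ce
  have am : ∀ (f : Ω → ℝ) (i j k i' j' k' : ℤ), i ≤ i' → j ≤ j' → k ≤ k' →
      AEStronglyMeasurable[F i' j' k'] (μ[f|F i j k]) μ := fun f i j k i' j' k' hi hj hk =>
    (stronglyMeasurable_condExp.mono (hFmono hi hj hk)).aestronglyMeasurable
  have key : ∀ N : ℤ, i ≤ N → j ≤ N → k ≤ N →
      μ[μ[f1|F N N N] * μ[f2|F N N N] * μ[f3|F N N N]|F i j k] =ᵐ[μ] a1 * a2 * a3 := by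
    intro N hi hj hk
    set g1 := μ[f1|F N N N] with hg1
    set g2 := μ[f2|F N N N] with hg2
    set g3 := μ[f3|F N N N] with hg3
    have c1 : HhBd μ g1 := h1.ce
    have c2 : HhBd μ g2 := h2.ce
    have c3 : HhBd μ g3 := h3.ce
    have s1 : μ[g1 * g2 * g3|F N N k] =ᵐ[μ] g1 * g2 * a3 := by
      have q1 : AEStronglyMeasurable[F N N k] g1 μ :=
        (am f1 N N k N N k le_rfl le_rfl le_rfl).congr (e1 N N k N N)
      have q2 : AEStronglyMeasurable[F N N k] g2 μ :=
        (am f2 N N k N N k le_rfl le_rfl le_rfl).congr (e2 N N k N N)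
      refine (condExp_mul_of_aestronglyMeasurable_left (q1.mul q2) ((c1.mul c2).mul c3).1
        c3.1).trans ?_
      refine EventuallyEq.mul EventuallyEq.rfl ?_
      exact (condExp_condExp_of_le (hFmono le_rfl le_rfl hk) (hFle _ _ _)).trans (e3 _ _ _ _ _)
    have s2 : μ[g1 * g2 * a3|F N j N] =ᵐ[μ] g1 * a2 * a3 := by
      have q1 : AEStronglyMeasurable[F N j N] g1 μ :=
        (am f1 N j N N j N le_rfl le_rfl le_rfl).congr (e1 N j N N N)
      have q2 : AEStronglyMeasurable[F N j N] a3 μ := am f3 i j k N j N hi le_rfl hk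
      have r : g1 * g2 * a3 = g1 * a3 * g2 := by ring
      have r' : g1 * a2 * a3 = g1 * a3 * a2 := by ring
      rw [r, r']
      refine (condExp_mul_of_aestronglyMeasurable_left (q1.mul q2) ((c1.mul b3).mul c2).1
        c2.1).trans ?_
      refine EventuallyEq.mul EventuallyEq.rfl ?_
      exact (condExp_condExp_of_le (hFmono le_rfl hj le_rfl) (hFle _ _ _)).trans (e2 _ _ _ _ _)
    have s3 : μ[g1 * a2 * a3|F i j k] =ᵐ[μ] a1 * a2 * a3 := by
      have q1 : AEStronglyMeasurable[F i j k] a2 μ := am f2 i j k i j k le_rfl le_rfl le_rfl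
      have q2 : AEStronglyMeasurable[F i j k] a3 μ := am f3 i j k i j k le_rfl le_rfl le_rfl
      have r : g1 * a2 * a3 = a2 * a3 * g1 := by ring
      have r' : a1 * a2 * a3 = a2 * a3 * a1 := by ring
      rw [r, r']
      refine (condExp_mul_of_aestronglyMeasurable_left (q1.mul q2) ((b2.mul b3).mul c1).1
        c1.1).trans ?_
      refine EventuallyEq.mul EventuallyEq.rfl ?_
      exact condExp_condExp_of_le (hFmono hi hj hk) (hFle _ _ _)
    have t1 := condExp_condExp_of_le (f := g1 * g2 * g3) (μ := μ)
      (hFmono hi hj (le_refl k)) (hFle N N k)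
    have t2 := condExp_condExp_of_le (f := g1 * g2 * a3) (μ := μ)
      (hFmono hi (le_refl j) hk) (hFle N j N)
    exact t1.symm.trans ((condExp_congr_ae s1).trans
      (t2.symm.trans ((condExp_congr_ae s2).trans s3)))
  let ℱ : Filtration ℕ m0 := ⟨fun n => F n n n, fun n n' h => hFmono (by exact_mod_cast h)
    (by exact_mod_cast h) (by exact_mod_cast h), fun n => hFle _ _ _⟩
  have htop : m0 ≤ ⨆ n, ℱ n := by
    conv_lhs => rw [← hFtop]
    unfold extFiltration
    refine iSup_le fun a => iSup_le fun _ => iSup_le fun b => iSup_le fun _ => iSup_le fun c =>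
      iSup_le fun _ => ?_
    refine le_trans ?_ (le_iSup (fun n => ℱ n) (a.toNat + b.toNat + c.toNat))
    exact hFmono (by push_cast; omega) (by push_cast; omega) (by push_cast; omega)
  have lev : ∀ f : Ω → ℝ, Integrable f μ → StronglyMeasurable f →
      ∀ᵐ x ∂μ, Tendsto (fun n : ℕ => (μ[f|F n n n]) x) atTop (𝓝 (f x)) := by
    intro f hf hm
    exact hf.tendsto_ae_condExp (ℱ := ℱ) (hm.mono htop)
  obtain ⟨n0, hn0⟩ : ∃ n0 : ℕ, i ≤ n0 ∧ j ≤ n0 ∧ k ≤ n0 :=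
    ⟨i.toNat + j.toNat + k.toNat, by push_cast; omega, by push_cast; omega, by push_cast; omega⟩
  have b : HhBd μ (a1 * a2 * a3) := (b1.mul b2).mul b3
  have bm : StronglyMeasurable[F i j k] (a1 * a2 * a3) :=
    (stronglyMeasurable_condExp.mul stronglyMeasurable_condExp).mul stronglyMeasurable_condExp
  have hfix : μ[a1 * a2 * a3|F i j k] = a1 * a2 * a3 :=
    condExp_of_stronglyMeasurable (hFle _ _ _) bm b.1
  let fs : ℕ → Ω → ℝ := fun n => μ[f1|F ((n + n0 : ℕ) : ℤ) ((n + n0 : ℕ) : ℤ) ((n + n0 : ℕ) : ℤ)]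
    * μ[f2|F ((n + n0 : ℕ) : ℤ) ((n + n0 : ℕ) : ℤ) ((n + n0 : ℕ) : ℤ)]
    * μ[f3|F ((n + n0 : ℕ) : ℤ) ((n + n0 : ℕ) : ℤ) ((n + n0 : ℕ) : ℤ)]
  have fsb : ∀ n, HhBd μ (fs n) := fun n => (h1.ce.mul h2.ce).mul h3.ce
  have := tendsto_condExp_unique (m := F i j k) (μ := μ) fs (fun _ => a1 * a2 * a3)
    (f1 * f2 * f3) (a1 * a2 * a3) (fun n => (fsb n).1) (fun _ => b.1)
    (by
      filter_upwards [lev f1 h1.1 m1, lev f2 h2.1 m2, lev f3 h3.1 m3] with x l1 l2 l3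
      have ht : Tendsto (fun n : ℕ => n + n0) atTop atTop := tendsto_add_atTop_nat n0
      exact ((l1.comp ht).mul (l2.comp ht)).mul (l3.comp ht))
    (ae_of_all _ fun x => tendsto_const_nhds) (fun _ => 1) (integrable_const _) (fun _ => 1)
    (integrable_const _) (fun n => (fsb n).2) (fun _ => b.2)
    (fun n => by
      rw [hfix]
      exact key _ (by push_cast; omega) (by push_cast; omega) (by push_cast; omega))
  rw [hfix] at this
  exact this

theorem hh_inv {Ω : Type*} {m0 : MeasurableSpace Ω} {μ : Measure Ω} (T : ℤ × ℤ × ℤ → Ω → Ω)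
    (hcomm : ∀ p q x, T p (T q x) = T q (T p x)) (hTm : ∀ p, MeasurePreserving (T p) μ μ)
    (ι : ℤ × ℤ → ℤ × ℤ × ℤ) (p : ℤ × ℤ × ℤ) :
    (invariantSets m0 (fun q => T (ι q))).comap (T p) ≤ invariantSets m0 (fun q => T (ι q)) := by
  rintro s ⟨t, ⟨htm, hti⟩, rfl⟩
  refine ⟨(hTm p).measurable htm, fun q => ?_⟩
  have hq : T (ι q) ⁻¹' t = t := hti q
  ext x
  change T p (T (ι q) x) ∈ t ↔ T p x ∈ t
  rw [hcomm]
  conv_rhs => rw [← hq]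
  rfl

/-- **`(I ⊓ F_{i,j,k})` is a completely commuting invariant filtration.**
For an ergodic measure-preserving `ℤ³`-action with a completely commuting invariant
filtration `F` satisfying `F_{∞,∞,∞} = A`, and `I = I̅₁ ∨ I̅₂ ∨ I̅₃` the join of the
σ-algebras of sets invariant under the three coordinate `ℤ²`-sub-actions, the family
`(I ⊓ F_{i,j,k})` is again a completely commuting invariant filtration for `T`. -/
theorem inf_factorI_completely_commuting_invariant_filtration
    {Ω : Type*} [m0 : MeasurableSpace Ω] (μ : Measure Ω) [IsProbabilityMeasure μ]
    (T : ℤ × ℤ × ℤ → Ω → Ω)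
    (hT0 : T 0 = id)
    (hTadd : ∀ p q : ℤ × ℤ × ℤ, T (p + q) = T p ∘ T q)
    (hTmp : ∀ p, MeasurePreserving (T p) μ μ)
    (hTerg : ∀ s : Set Ω, MeasurableSet s → (∀ p, T p ⁻¹' s = s) → μ s = 0 ∨ μ s = 1)
    (F : ℤ → ℤ → ℤ → MeasurableSpace Ω)
    (hFle : ∀ i j k, F i j k ≤ m0)
    (hFinv : ∀ i j k : ℤ, F i j k = (F 0 0 0).comap (T (i, j, k)))
    (hFmono : ∀ ⦃i j k i' j' k' : ℤ⦄, i ≤ i' → j ≤ j' → k ≤ k' → F i j k ≤ F i' j' k')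
    (hFcc : ∀ f : Ω → ℝ, Integrable f μ → ∀ i j k i' j' k' : ℤ,
      μ[μ[f|F i j k]|F i' j' k'] =ᵐ[μ] μ[f|F (min i i') (min j j') (min k k')])
    (hFtop : extFiltration F ⊤ ⊤ ⊤ = m0)
    (I : MeasurableSpace Ω)
    (hI : I = invariantSets m0 (fun p : ℤ × ℤ => T (0, p.1, p.2)) ⊔
      invariantSets m0 (fun p : ℤ × ℤ => T (p.1, 0, p.2)) ⊔
      invariantSets m0 (fun p : ℤ × ℤ => T (p.1, p.2, 0)))
    :
    (∀ i j k : ℤ, I ⊓ F i j k = (I ⊓ F 0 0 0).comap (T (i, j, k))) ∧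
    (∀ f : Ω → ℝ, Integrable f μ → ∀ i j k i' j' k' : ℤ,
      μ[μ[f|I ⊓ F i j k]|I ⊓ F i' j' k'] =ᵐ[μ]
        μ[f|I ⊓ F (min i i') (min j j') (min k k')]) := by
  have hle1 : invariantSets m0 (fun p : ℤ × ℤ => T (0, p.1, p.2)) ≤ m0 := fun s hs => hs.1
  have hle2 : invariantSets m0 (fun p : ℤ × ℤ => T (p.1, 0, p.2)) ≤ m0 := fun s hs => hs.1
  have hle3 : invariantSets m0 (fun p : ℤ × ℤ => T (p.1, p.2, 0)) ≤ m0 := fun s hs => hs.1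
  have hIle : I ≤ m0 := by
    rw [hI]
    exact sup_le (sup_le hle1 hle2) hle3
  have hcomm : ∀ p q x, T p (T q x) = T q (T p x) := by
    intro p q x
    have h1 := congrFun (hTadd p q) x
    have h2 := congrFun (hTadd q p) x
    rw [add_comm q p] at h2
    exact h1.symm.trans h2
  have hneg : ∀ p x, T (-p) (T p x) = x := by
    intro p x
    have h1 := congrFun (hTadd (-p) p) x
    rw [neg_add_cancel, hT0] at h1
    exact h1.symm
  have hneg' : ∀ p x, T p (T (-p) x) = x := by
    intro p x
    rw [hcomm, hneg]
  have hinvc : ∀ (ι : ℤ × ℤ → ℤ × ℤ × ℤ) (p : ℤ × ℤ × ℤ),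
      (invariantSets m0 (fun q => T (ι q))).comap (T p) ≤ invariantSets m0 (fun q => T (ι q)) := by
    exact fun ι p => hh_inv T hcomm (μ := μ) hTmp ι p
  have hIc : ∀ p, I.comap (T p) ≤ I := by
    intro p
    rw [hI, MeasurableSpace.comap_sup, MeasurableSpace.comap_sup]
    exact sup_le_sup (sup_le_sup (hinvc (fun q => (0, q.1, q.2)) p)
      (hinvc (fun q => (q.1, 0, q.2)) p)) (hinvc (fun q => (q.1, q.2, 0)) p)
  have hFadd : ∀ (i j k a b c : ℤ), F (i + a) (j + b) (k + c) = (F i j k).comap (T (a, b, c)) := by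
    intro i j k a b c
    rw [hFinv (i + a) (j + b) (k + c), hFinv i j k, MeasurableSpace.comap_comp, ← hTadd]
    rfl
  refine ⟨?_, ?_⟩
  · intro i j k
    apply le_antisymm
    · intro s hs
      obtain ⟨hsI, hsF⟩ := MeasurableSpace.measurableSet_inf.1 hs
      have e : T (i, j, k) ⁻¹' (T (-(i, j, k)) ⁻¹' s) = s := by
        ext x
        simp only [Set.mem_preimage, hneg]
      refine ⟨T (-(i, j, k)) ⁻¹' s, MeasurableSpace.measurableSet_inf.2 ⟨?_, ?_⟩, e⟩
      · exact hIc _ _ ⟨s, hsI, rfl⟩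
      · rw [hFinv i j k] at hsF
        obtain ⟨t, ht, rfl⟩ := hsF
        have e2 : T (-(i, j, k)) ⁻¹' (T (i, j, k) ⁻¹' t) = t := by
          ext x
          simp only [Set.mem_preimage, hneg']
        rw [e2]
        exact ht
    · rintro s ⟨t, ht, rfl⟩
      obtain ⟨htI, htF⟩ := MeasurableSpace.measurableSet_inf.1 ht
      refine MeasurableSpace.measurableSet_inf.2 ⟨hIc _ _ ⟨t, htI, rfl⟩, ?_⟩
      rw [hFinv i j k]
      exact ⟨t, htF, rfl⟩
  -- directional facts
  have d1 := fun (i : ℤ) (s : Set Ω)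
      (hs : MeasurableSet[invariantSets m0 (fun p : ℤ × ℤ => T (0, p.1, p.2))] s) =>
    hh_dir (μ := μ) (fun p : ℤ × ℤ => T (0, p.1, p.2))
      (fun p q => by rw [← hTadd]; rfl) (fun p => hTmp _)
      (fun p => F i p.1 p.2) (fun p => hFle _ _ _) (fun p q h => hFmono le_rfl h.1 h.2)
      (fun p q => by simpa using hFadd i p.1 p.2 0 q.1 q.2) hs
  have d2 := fun (j : ℤ) (s : Set Ω)
      (hs : MeasurableSet[invariantSets m0 (fun p : ℤ × ℤ => T (p.1, 0, p.2))] s) =>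
    hh_dir (μ := μ) (fun p : ℤ × ℤ => T (p.1, 0, p.2))
      (fun p q => by rw [← hTadd]; rfl) (fun p => hTmp _)
      (fun p => F p.1 j p.2) (fun p => hFle _ _ _) (fun p q h => hFmono h.1 le_rfl h.2)
      (fun p q => by simpa using hFadd p.1 j p.2 q.1 0 q.2) hs
  have d3 := fun (k : ℤ) (s : Set Ω)
      (hs : MeasurableSet[invariantSets m0 (fun p : ℤ × ℤ => T (p.1, p.2, 0))] s) =>
    hh_dir (μ := μ) (fun p : ℤ × ℤ => T (p.1, p.2, 0))
      (fun p q => by rw [← hTadd]; rfl) (fun p => hTmp _)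
      (fun p => F p.1 p.2 k) (fun p => hFle _ _ _) (fun p q h => hFmono h.1 h.2 le_rfl)
      (fun p q => by simpa using hFadd p.1 p.2 k q.1 q.2 0) hs
  generalize hJ1 : invariantSets m0 (fun p : ℤ × ℤ => T (0, p.1, p.2)) = J1 at *
  generalize hJ2 : invariantSets m0 (fun p : ℤ × ℤ => T (p.1, 0, p.2)) = J2 at *
  generalize hJ3 : invariantSets m0 (fun p : ℤ × ℤ => T (p.1, p.2, 0)) = J3 at *
  have l1 : J1 ≤ I := by rw [hI]; exact le_sup_left.trans le_sup_left
  have l2 : J2 ≤ I := by rw [hI]; exact le_sup_right.trans le_sup_left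
  have l3 : J3 ≤ I := by rw [hI]; exact le_sup_right
  let C : Set (Set Ω) := {s | ∃ s1 s2 s3, MeasurableSet[J1] s1 ∧ MeasurableSet[J2] s2 ∧
    MeasurableSet[J3] s3 ∧ s = s1 ∩ s2 ∩ s3}
  have hCpi : IsPiSystem C := by
    rintro _ ⟨s1, s2, s3, h1, h2, h3, rfl⟩ _ ⟨t1, t2, t3, k1, k2, k3, rfl⟩ _
    exact ⟨s1 ∩ t1, s2 ∩ t2, s3 ∩ t3, @MeasurableSet.inter _ J1 _ _ h1 k1,
      @MeasurableSet.inter _ J2 _ _ h2 k2, @MeasurableSet.inter _ J3 _ _ h3 k3, by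
        ext x; simp only [Set.mem_inter_iff]; tauto⟩
  have hCgen : I = MeasurableSpace.generateFrom C := by
    apply le_antisymm
    · rw [hI]
      refine sup_le (sup_le ?_ ?_) ?_
      · intro s hs
        exact MeasurableSpace.measurableSet_generateFrom ⟨s, Set.univ, Set.univ, hs,
          @MeasurableSet.univ _ J2, @MeasurableSet.univ _ J3, by simp⟩
      · intro s hs
        exact MeasurableSpace.measurableSet_generateFrom ⟨Set.univ, s, Set.univ,
          @MeasurableSet.univ _ J1, hs, @MeasurableSet.univ _ J3, by simp⟩
      · intro s hs
        exact MeasurableSpace.measurableSet_generateFrom ⟨Set.univ, Set.univ, s,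
          @MeasurableSet.univ _ J1, @MeasurableSet.univ _ J2, hs, by simp⟩
    · refine MeasurableSpace.generateFrom_le ?_
      rintro _ ⟨s1, s2, s3, h1, h2, h3, rfl⟩
      exact @MeasurableSet.inter _ I _ _ (@MeasurableSet.inter _ I _ _ (l1 _ h1) (l2 _ h2))
        (l3 _ h3)
  have bd : ∀ s : Set Ω, MeasurableSet[m0] s → HhBd μ (s.indicator (fun _ => (1:ℝ))) := by
    intro s hs
    refine ⟨(integrable_const (1:ℝ)).indicator hs, ae_of_all _ fun x => ?_⟩
    by_cases hx : x ∈ s <;> simp [hx]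
  have hIF : ∀ i j k, I ⊓ F i j k ≤ m0 := fun i j k => inf_le_left.trans hIle
  have main : ∀ i j k (h : Ω → ℝ), Integrable h μ → AEStronglyMeasurable[I] h μ →
      μ[h|F i j k] =ᵐ[μ] μ[h|I ⊓ F i j k] := by
    intro i j k h hh hhm
    refine hh_ext (hFle i j k) (hIF i j k) hIle C hCpi hCgen ?_ hh hhm
    rintro _ ⟨s1, s2, s3, h1, h2, h3, rfl⟩
    have hp := hh_prod (μ := μ) F hFle hFmono hFtop (bd s1 (hle1 _ h1)) (bd s2 (hle2 _ h2))
      (bd s3 (hle3 _ h3))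
      (stronglyMeasurable_const.indicator (hle1 _ h1))
      (stronglyMeasurable_const.indicator (hle2 _ h2))
      (stronglyMeasurable_const.indicator (hle3 _ h3))
      (fun i j k j' k' => (d1 i s1 h1).1 (j, k) (j', k'))
      (fun i j k i' k' => (d2 j s2 h2).1 (i, k) (i', k'))
      (fun i j k i' j' => (d3 k s3 h3).1 (i, j) (i', j')) i j k
    have a1 : AEStronglyMeasurable[I ⊓ F i j k] (μ[s1.indicator (fun _ => (1:ℝ))|F i j k]) μ :=
      ((d1 i s1 h1).2 (j, k)).mono (inf_le_inf_right _ l1)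
    have a2 : AEStronglyMeasurable[I ⊓ F i j k] (μ[s2.indicator (fun _ => (1:ℝ))|F i j k]) μ :=
      ((d2 j s2 h2).2 (i, k)).mono (inf_le_inf_right _ l2)
    have a3 : AEStronglyMeasurable[I ⊓ F i j k] (μ[s3.indicator (fun _ => (1:ℝ))|F i j k]) μ :=
      ((d3 k s3 h3).2 (i, j)).mono (inf_le_inf_right _ l3)
    have e : (s1 ∩ s2 ∩ s3).indicator (fun _ => (1:ℝ)) = s1.indicator (fun _ => (1:ℝ)) *
        s2.indicator (fun _ => (1:ℝ)) * s3.indicator (fun _ => (1:ℝ)) := by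
      funext x
      by_cases x1 : x ∈ s1 <;> by_cases x2 : x ∈ s2 <;> by_cases x3 : x ∈ s3 <;>
        simp [x1, x2, x3]
    rw [e]
    have am := ((a1.mul a2).mul a3).congr hp.symm
    exact (condExp_of_aestronglyMeasurable' (hIF i j k) am integrable_condExp).symm.trans
      (condExp_condExp_of_le inf_le_right (hFle i j k))
  intro f hf i j k i' j' k'
  have hIm : ∀ g : Ω → ℝ, AEStronglyMeasurable[I] (μ[g|I]) μ := fun g =>
    stronglyMeasurable_condExp.aestronglyMeasurable
  -- reduce to `μ[f|I]`
  have r : ∀ i j k, μ[f|I ⊓ F i j k] =ᵐ[μ] μ[μ[f|I]|F i j k] := fun i j k =>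
    (condExp_condExp_of_le inf_le_left hIle).symm.trans
      (main i j k _ integrable_condExp (hIm f)).symm
  have hg : AEStronglyMeasurable[I] (μ[f|I ⊓ F i j k]) μ :=
    (stronglyMeasurable_condExp.mono inf_le_left).aestronglyMeasurable
  exact (main i' j' k' _ integrable_condExp hg).symm.trans
    ((condExp_congr_ae (r i j k)).trans
      ((hFcc _ integrable_condExp i j k i' j' k').trans (r _ _ _).symm))
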